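/- arXiv:1709.05942 — 2 statements merged into one kernel-verified Lean document; each statement's English description precedes it below -/
import Mathlib

section
/- Let (W,S) be a Coxeter system, let J ⊆ S, and let w, v ∈ W be such that v ≤ w in the Bruhat order and v is the minimal-length element of the coset W_J v. Then the set C(w,v) := {z ∈ W : v ≤ z ≤ w and z v⁻¹ ∈ W_J} has a unique maximal element with respect to the Bruhat order. -/
/-- The Bruhat order on a Coxeter group: `u ≤ w` iff some (equivalently, every) reduced word
for `w` contains a subword which is a reduced word for `u`. -/
def CoxeterSystem.BruhatLE {B W : Type*} [Group W] {M : CoxeterMatrix B}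
    (cs : CoxeterSystem M W) (u w : W) : Prop :=
  ∃ ω : List B, cs.IsReduced ω ∧ cs.wordProd ω = w ∧
    ∃ ω' : List B, ω'.Sublist ω ∧ cs.IsReduced ω' ∧ cs.wordProd ω' = u

namespace CoxeterSystem

variable {B W : Type*} [Group W] {M : CoxeterMatrix B} (cs : CoxeterSystem M W)

/-! ### The signed permutation representation and the strong exchange property -/

open Classical in
/-- The action of a simple reflection `s` on `W × ℤ/2`, given by
`(t, e) ↦ (s t s, e + [t = s])`. -/
noncomputable def signedConj (i : B) : Function.End (W × ZMod 2) :=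
  fun p ↦ (cs.simple i * p.1 * cs.simple i, p.2 + if p.1 = cs.simple i then 1 else 0)

theorem simple_mul_pow (i j : B) (k : ℕ) :
    cs.simple j * (cs.simple i * cs.simple j) ^ k =
      (cs.simple j * cs.simple i) ^ k * cs.simple j := by
  induction k with
  | zero => simp
  | succ k ih => rw [pow_succ, ← mul_assoc, ih, pow_succ]; simp only [mul_assoc]

theorem inv_simple_mul_simple_pow (i j : B) (k : ℕ) :
    ((cs.simple i * cs.simple j) ^ k)⁻¹ = (cs.simple j * cs.simple i) ^ k := by
  rw [← inv_pow, mul_inv_rev, inv_simple, inv_simple]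

open Classical in
theorem signedConj_mul_pow_apply (i j : B) (k : ℕ) (t : W) (e : ZMod 2) :
    ((cs.signedConj i * cs.signedConj j) ^ k) (t, e) =
      ((cs.simple i * cs.simple j) ^ k * t * ((cs.simple i * cs.simple j) ^ k)⁻¹,
        e + ∑ l ∈ Finset.range (2 * k),
          if t = (cs.simple j * cs.simple i) ^ l * cs.simple j then 1 else 0) := by
  induction k with
  | zero => simp; rfl
  | succ k ih =>
    rw [pow_succ']
    change cs.signedConj i (cs.signedConj j (((cs.signedConj i * cs.signedConj j) ^ k) (t, e))) = _
    rw [ih]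
    set x := cs.simple i * cs.simple j with hx
    have h1 : x ^ k * t * (x ^ k)⁻¹ = cs.simple j ↔
        t = (cs.simple j * cs.simple i) ^ (2 * k) * cs.simple j := by
      rw [mul_inv_eq_iff_eq_mul, ← eq_inv_mul_iff_mul_eq, hx, simple_mul_pow,
        inv_simple_mul_simple_pow, ← mul_assoc, ← pow_add, two_mul]
    have h2 : cs.simple j * (x ^ k * t * (x ^ k)⁻¹) * cs.simple j = cs.simple i ↔
        t = (cs.simple j * cs.simple i) ^ (2 * k + 1) * cs.simple j := by
      have h3 : cs.simple j * (x ^ k * t * (x ^ k)⁻¹) * cs.simple j = cs.simple i ↔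
          x ^ k * t * (x ^ k)⁻¹ = cs.simple j * cs.simple i * cs.simple j := by
        constructor
        · intro h; rw [← h]; simp [mul_assoc]
        · intro h; rw [h]; simp [mul_assoc]
      rw [h3, mul_inv_eq_iff_eq_mul, ← eq_inv_mul_iff_mul_eq, hx, mul_assoc, simple_mul_pow,
        inv_simple_mul_simple_pow, ← mul_assoc, ← mul_assoc, ← pow_succ, ← pow_add]
      congr! 3
      omega
    simp only [signedConj, h1, h2, Prod.mk.injEq]
    constructor
    · rw [pow_succ' x, mul_inv_rev, hx, mul_inv_rev, inv_simple, inv_simple]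
      simp only [mul_assoc]
    · rw [show 2 * (k + 1) = 2 * k + 1 + 1 by ring, Finset.sum_range_succ,
        Finset.sum_range_succ]
      ring

theorem isLiftable_signedConj : M.IsLiftable cs.signedConj := by
  classical
  intro i j
  funext ⟨t, e⟩
  rw [signedConj_mul_pow_apply, simple_mul_simple_pow, two_mul, Finset.sum_range_add]
  simp only [pow_add, simple_mul_simple_pow', one_mul]
  rw [CharTwo.add_self_eq_zero]
  simp
  rfl

/-- The representation of `W` on `W × ℤ/2` extending `signedConj`. -/
noncomputable def signedConjHom : W →* Function.End (W × ZMod 2) :=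
  cs.lift ⟨cs.signedConj, cs.isLiftable_signedConj⟩

/-- The parity of the number of occurrences of `t` in the right inversion sequence of any word
for `w`. -/
noncomputable def invParity (w t : W) : ZMod 2 := (cs.signedConjHom w (t, 0)).2

open Classical in
theorem signedConjHom_wordProd (ω : List B) (t : W) (e : ZMod 2) :
    cs.signedConjHom (cs.wordProd ω) (t, e) =
      (cs.wordProd ω * t * (cs.wordProd ω)⁻¹, e + (cs.rightInvSeq ω).count t) := by
  induction ω with
  | nil => simp; rfl
  | cons i ω ih =>
    rw [wordProd_cons, map_mul]
    change cs.signedConjHom (cs.simple i) (cs.signedConjHom (cs.wordProd ω) (t, e)) = _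
    rw [ih, signedConjHom, lift_apply_simple]
    simp only [signedConj, Prod.mk.injEq, rightInvSeq, List.count_cons, beq_iff_eq]
    constructor
    · simp [mul_assoc]
    · have : cs.wordProd ω * t * (cs.wordProd ω)⁻¹ = cs.simple i ↔
          (cs.wordProd ω)⁻¹ * cs.simple i * cs.wordProd ω = t := by
        rw [mul_inv_eq_iff_eq_mul, mul_assoc, inv_mul_eq_iff_eq_mul, eq_comm]
      simp only [this]
      push_cast
      ring

theorem signedConjHom_apply (w t : W) (e : ZMod 2) :
    cs.signedConjHom w (t, e) = (w * t * w⁻¹, e + cs.invParity w t) := by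
  classical
  obtain ⟨ω, rfl⟩ := cs.wordProd_surjective w
  simp [invParity, signedConjHom_wordProd]

open Classical in
theorem invParity_wordProd (ω : List B) (t : W) :
    cs.invParity (cs.wordProd ω) t = (cs.rightInvSeq ω).count t := by
  simp [invParity, signedConjHom_wordProd]

theorem invParity_mul (w w' t : W) :
    cs.invParity (w * w') t = cs.invParity w' t + cs.invParity w (w' * t * w'⁻¹) := by
  rw [invParity, map_mul]
  change (cs.signedConjHom w (cs.signedConjHom w' (t, 0))).2 = _
  simp [signedConjHom_apply]

theorem invParity_one (t : W) : cs.invParity 1 t = 0 := by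
  simpa using cs.invParity_wordProd [] t

open Classical in
theorem invParity_simple (i : B) (t : W) :
    cs.invParity (cs.simple i) t = if t = cs.simple i then 1 else 0 := by
  have h := cs.invParity_wordProd [i] t
  rw [wordProd_singleton, rightInvSeq_singleton, List.count_singleton] at h
  rw [h]
  by_cases hti : t = cs.simple i
  · simp [hti]
  · simp [hti, Ne.symm hti]

variable {cs}

theorem IsReflection.invParity_self {t : W} (ht : cs.IsReflection t) :
    cs.invParity t t = 1 := by
  obtain ⟨u, i, rfl⟩ := ht
  have h := cs.invParity_mul u u⁻¹ (u * cs.simple i * u⁻¹)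
  have hc : u⁻¹ * (u * cs.simple i * u⁻¹) * u⁻¹⁻¹ = cs.simple i := by group
  rw [mul_inv_cancel, invParity_one, hc] at h
  rw [invParity_mul, invParity_mul, hc, mul_inv_cancel_right, invParity_simple, if_pos rfl,
    add_left_comm, ← h, add_zero]

variable (cs)

theorem mem_rightInvSeq_of_invParity_ne_zero {ω : List B} {t : W}
    (h : cs.invParity (cs.wordProd ω) t ≠ 0) : t ∈ cs.rightInvSeq ω := by
  classical
  by_contra hmem
  rw [invParity_wordProd, List.count_eq_zero_of_not_mem hmem] at h
  simp at h

theorem length_mul_lt_of_invParity_ne_zero {w t : W} (h : cs.invParity w t ≠ 0) :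
    cs.length (w * t) < cs.length w := by
  obtain ⟨ω, hω, rfl⟩ := cs.exists_isReduced w
  exact (cs.isRightInversion_of_mem_rightInvSeq hω (cs.mem_rightInvSeq_of_invParity_ne_zero h)).2

variable {cs}

theorem IsReflection.length_mul_lt_iff {w t : W} (ht : cs.IsReflection t) :
    cs.length (w * t) < cs.length w ↔ cs.invParity w t ≠ 0 := by
  refine ⟨fun h h0 ↦ ?_, cs.length_mul_lt_of_invParity_ne_zero⟩
  have h1 : cs.invParity (w * t) t ≠ 0 := by
    simp [invParity_mul, ht.invParity_self, h0]
  have h2 := cs.length_mul_lt_of_invParity_ne_zero h1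
  rw [mul_assoc, ht.mul_self, mul_one] at h2
  omega

/-- The strong exchange property. -/
theorem IsReflection.exists_wordProd_eraseIdx {ω : List B} {t : W} (ht : cs.IsReflection t)
    (h : cs.length (cs.wordProd ω * t) < cs.length (cs.wordProd ω)) :
    ∃ j < ω.length, cs.wordProd ω * t = cs.wordProd (ω.eraseIdx j) := by
  have hmem := cs.mem_rightInvSeq_of_invParity_ne_zero (ht.length_mul_lt_iff.1 h)
  obtain ⟨j, hj, rfl⟩ := List.getElem_of_mem hmem
  refine ⟨j, by simpa using hj, ?_⟩
  rw [← wordProd_mul_getD_rightInvSeq, List.getD_eq_getElem _ _ hj]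

theorem IsReflection.length_mul_simple_lt {u t : W} (ht : cs.IsReflection t) {i : B}
    (h : cs.length u < cs.length (u * t)) (hti : t ≠ cs.simple i) :
    cs.length (u * cs.simple i) < cs.length (u * t * cs.simple i) := by
  have ht' : cs.IsReflection (cs.simple i * t * cs.simple i) := by
    simpa using ht.conj (cs.simple i)
  have h0 : cs.invParity u t = 0 := by
    by_contra h0
    exact absurd (ht.length_mul_lt_iff.2 h0) (by omega)
  have hne : cs.simple i * t * cs.simple i ≠ cs.simple i := by
    intro h1
    rw [mul_eq_right] at h1
    exact hti (by rw [eq_inv_of_mul_eq_one_right h1, inv_simple])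
  have h1 : ¬ cs.length (u * cs.simple i * (cs.simple i * t * cs.simple i)) <
      cs.length (u * cs.simple i) := by
    rw [ht'.length_mul_lt_iff, not_not, invParity_mul, invParity_simple, if_neg hne]
    simpa [mul_assoc] using h0
  have h2 := ht'.length_mul_left_ne (u * cs.simple i)
  have h3 : u * cs.simple i * (cs.simple i * t * cs.simple i) = u * t * cs.simple i := by
    simp [mul_assoc]
  rw [h3] at h1 h2
  omega

variable (cs)

theorem exists_isReduced_sublist (ω : List B) :
    ∃ ω' : List B, ω'.Sublist ω ∧ cs.IsReduced ω' ∧ cs.wordProd ω' = cs.wordProd ω := by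
  induction ω using List.reverseRecOn with
  | nil => exact ⟨[], List.Sublist.refl _, by simp [IsReduced], rfl⟩
  | append_singleton ω i ih =>
    obtain ⟨α, hsub, hred, hprod⟩ := ih
    have hp : cs.wordProd (ω ++ [i]) = cs.wordProd α * cs.simple i := by
      rw [wordProd_append, hprod, wordProd_singleton]
    rcases cs.length_mul_simple (cs.wordProd α) i with h | h
    · refine ⟨α ++ [i], hsub.append (List.Sublist.refl _), ?_, ?_⟩
      · rw [IsReduced, wordProd_append, wordProd_singleton, h, hred.eq]; simp
      · rw [hp, wordProd_append, wordProd_singleton]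
    · obtain ⟨j, hj, he⟩ := (cs.isReflection_simple i).exists_wordProd_eraseIdx
        (ω := α) (by omega)
      refine ⟨α.eraseIdx j, ((List.eraseIdx_sublist α j).trans hsub).trans
        (List.sublist_append_left _ _), ?_, by rw [hp, he]⟩
      have := hred.eq
      rw [IsReduced, ← he, List.length_eraseIdx_of_lt hj]
      omega

/-! ### The Bruhat order through chains of reflections -/

/-- `w` is obtained from `u` by a length-increasing right multiplication by a reflection. -/
def BruhatStep (u w : W) : Prop :=
  ∃ t, cs.IsReflection t ∧ w = u * t ∧ cs.length u < cs.length w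

/-- The Bruhat order as the reflexive transitive closure of `BruhatStep`. -/
def ChainLE : W → W → Prop := Relation.ReflTransGen cs.BruhatStep

variable {cs}

theorem BruhatStep.chainLE {u w : W} (h : cs.BruhatStep u w) : cs.ChainLE u w :=
  Relation.ReflTransGen.single h

theorem ChainLE.trans {u v w : W} (h : cs.ChainLE u v) (h' : cs.ChainLE v w) :
    cs.ChainLE u w :=
  Relation.ReflTransGen.trans h h'

theorem ChainLE.eq_or_length_lt {u w : W} (h : cs.ChainLE u w) :
    u = w ∨ cs.length u < cs.length w := by
  induction h with
  | refl => exact Or.inl rfl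
  | tail _ hstep ih =>
    obtain ⟨t, -, -, hlt⟩ := hstep
    rcases ih with rfl | ih
    · exact Or.inr hlt
    · exact Or.inr (ih.trans hlt)

theorem ChainLE.antisymm {u w : W} (h : cs.ChainLE u w) (h' : cs.ChainLE w u) : u = w := by
  rcases h.eq_or_length_lt with h | h
  · exact h
  · rcases h'.eq_or_length_lt with h' | h'
    · exact h'.symm
    · omega

theorem BruhatStep.inv {u w : W} (h : cs.BruhatStep u w) : cs.BruhatStep u⁻¹ w⁻¹ := by
  obtain ⟨t, ht, rfl, hlt⟩ := h
  refine ⟨u * t * u⁻¹, ht.conj u, ?_, by simpa only [length_inv] using hlt⟩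
  rw [mul_inv_rev, ht.inv]
  group

theorem ChainLE.inv {u w : W} (h : cs.ChainLE u w) : cs.ChainLE u⁻¹ w⁻¹ :=
  Relation.ReflTransGen.lift (·⁻¹) (fun _ _ ↦ BruhatStep.inv) _ _ h

theorem chainLE_mul_simple {u : W} {i : B} (h : ¬ cs.IsRightDescent u i) :
    cs.ChainLE u (u * cs.simple i) :=
  BruhatStep.chainLE ⟨_, cs.isReflection_simple i, rfl, by
    rw [cs.not_isRightDescent_iff] at h; omega⟩

theorem mul_simple_chainLE {u : W} {i : B} (h : cs.IsRightDescent u i) :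
    cs.ChainLE (u * cs.simple i) u :=
  BruhatStep.chainLE ⟨_, cs.isReflection_simple i, by simp, h⟩

theorem BruhatStep.mul_simple_or {u w : W} (h : cs.BruhatStep u w) (i : B) :
    cs.BruhatStep (u * cs.simple i) (w * cs.simple i) ∨ w = u * cs.simple i := by
  obtain ⟨t, ht, rfl, hlt⟩ := h
  by_cases hti : t = cs.simple i
  · exact Or.inr (by rw [hti])
  · refine Or.inl ⟨cs.simple i * t * cs.simple i, ?_, ?_, ht.length_mul_simple_lt hlt hti⟩
    · simpa using ht.conj (cs.simple i)
    · simp [mul_assoc]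

theorem ChainLE.mul_simple_le_or_mul_simple_le {u w : W} (h : cs.ChainLE u w) (i : B) :
    cs.ChainLE (u * cs.simple i) (w * cs.simple i) ∨ cs.ChainLE (u * cs.simple i) w := by
  induction h using Relation.ReflTransGen.head_induction_on with
  | refl => exact Or.inl Relation.ReflTransGen.refl
  | head hstep hle ih =>
    rcases hstep.mul_simple_or i with h | rfl
    · exact ih.imp h.chainLE.trans h.chainLE.trans
    · exact Or.inr hle

theorem ChainLE.mul_simple_le_or_le_mul_simple {u w : W} (h : cs.ChainLE u w) (i : B) :
    cs.ChainLE (u * cs.simple i) (w * cs.simple i) ∨ cs.ChainLE u (w * cs.simple i) := by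
  induction h with
  | refl => exact Or.inl Relation.ReflTransGen.refl
  | tail hle hstep ih =>
    rcases hstep.mul_simple_or i with h | rfl
    · exact ih.imp (·.trans h.chainLE) (·.trans h.chainLE)
    · right
      rw [simple_mul_simple_cancel_right]
      exact hle

theorem ChainLE.mul_simple_le_of_not_isRightDescent {u w : W} (h : cs.ChainLE u w) {i : B}
    (hw : ¬ cs.IsRightDescent w i) : cs.ChainLE (u * cs.simple i) (w * cs.simple i) :=
  (h.mul_simple_le_or_mul_simple_le i).elim id (·.trans (chainLE_mul_simple hw))

theorem ChainLE.mul_simple_le_of_isRightDescent {u w : W} (h : cs.ChainLE u w) {i : B}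
    (hw : cs.IsRightDescent w i) : cs.ChainLE (u * cs.simple i) w :=
  (h.mul_simple_le_or_mul_simple_le i).elim (·.trans (mul_simple_chainLE hw)) id

theorem ChainLE.le_mul_simple {u w : W} (h : cs.ChainLE u w) {i : B}
    (hu : ¬ cs.IsRightDescent u i) : cs.ChainLE u (w * cs.simple i) :=
  (h.mul_simple_le_or_le_mul_simple i).elim (chainLE_mul_simple hu).trans id

theorem ChainLE.mul_simple_le_mul_simple {u w : W} (h : cs.ChainLE u w) {i : B}
    (hu : cs.IsRightDescent u i) : cs.ChainLE (u * cs.simple i) (w * cs.simple i) :=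
  (h.mul_simple_le_or_le_mul_simple i).elim id (mul_simple_chainLE hu).trans

theorem ChainLE.le_simple_mul {u w : W} (h : cs.ChainLE u w) {i : B}
    (hu : ¬ cs.IsLeftDescent u i) : cs.ChainLE u (cs.simple i * w) := by
  rw [← isRightDescent_inv_iff] at hu
  simpa using (h.inv.le_mul_simple hu).inv

/-! ### Comparison with the subword definition -/

theorem IsReduced.chainLE_of_sublist {ω ω' : List B} (hω : cs.IsReduced ω)
    (h : ω'.Sublist ω) : cs.ChainLE (cs.wordProd ω') (cs.wordProd ω) := by
  induction ω using List.reverseRecOn generalizing ω' with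
  | nil => rw [List.sublist_nil.1 h]; exact Relation.ReflTransGen.refl
  | append_singleton α i ih =>
    have hα : cs.IsReduced α := by simpa using hω.take α.length
    have hd : ¬ cs.IsRightDescent (cs.wordProd α) i := by
      have h1 := hω.eq
      rw [wordProd_append, wordProd_singleton, List.length_append, ← hα.eq] at h1
      rw [cs.not_isRightDescent_iff, h1, List.length_singleton]
    obtain ⟨α', β, rfl, hα', hβ⟩ := List.sublist_append_iff.1 h
    rw [wordProd_append, wordProd_append, wordProd_singleton]
    rcases List.sublist_singleton.1 hβ with rfl | rfl
    · rw [wordProd_nil, mul_one]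
      exact (ih hα hα').trans (chainLE_mul_simple hd)
    · rw [wordProd_singleton]
      exact (ih hα hα').mul_simple_le_of_not_isRightDescent hd

theorem ChainLE.exists_sublist {u : W} {ω : List B} (h : cs.ChainLE u (cs.wordProd ω)) :
    ∃ ω' : List B, ω'.Sublist ω ∧ cs.wordProd ω' = u := by
  induction h using Relation.ReflTransGen.head_induction_on with
  | refl => exact ⟨ω, List.Sublist.refl _, rfl⟩
  | head hstep _ ih =>
    obtain ⟨α, hα, rfl⟩ := ih
    obtain ⟨t, ht, he, hlt⟩ := hstep
    have he' := (mul_inv_eq_iff_eq_mul.2 he).symm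
    rw [ht.inv] at he'
    rw [he'] at hlt
    obtain ⟨j, -, hj⟩ := ht.exists_wordProd_eraseIdx hlt
    exact ⟨α.eraseIdx j, (List.eraseIdx_sublist α j).trans hα, by rw [he', hj]⟩

theorem bruhatLE_iff_chainLE {u w : W} : cs.BruhatLE u w ↔ cs.ChainLE u w := by
  constructor
  · rintro ⟨ω, hω, rfl, ω', hsub, -, rfl⟩
    exact hω.chainLE_of_sublist hsub
  · intro h
    obtain ⟨ω, hω, rfl⟩ := cs.exists_isReduced w
    obtain ⟨α, hα, rfl⟩ := h.exists_sublist
    obtain ⟨β, hβ, hred, hprod⟩ := cs.exists_isReduced_sublist α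
    exact ⟨ω, hω, rfl, β, hβ.trans hα, hred, hprod⟩

/-! ### Cosets of a standard parabolic subgroup -/

theorem isRightDescent_simple_mul_iff {x : W} {i r : B}
    (h : x⁻¹ * cs.simple r * x ≠ cs.simple i) :
    cs.IsRightDescent (cs.simple r * x) i ↔ cs.IsRightDescent x i := by
  have key : ∀ y : W, y⁻¹ * cs.simple r * y ≠ cs.simple i →
      cs.length y < cs.length (cs.simple r * y) →
      cs.length (y * cs.simple i) < cs.length (cs.simple r * y * cs.simple i) := by
    intro y hy hlt
    have he : cs.simple r * y = y * (y⁻¹ * cs.simple r * y) := by group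
    have ht : cs.IsReflection (y⁻¹ * cs.simple r * y) := by
      simpa using (cs.isReflection_simple r).conj y⁻¹
    rw [he] at hlt ⊢
    exact ht.length_mul_simple_lt hlt hy
  have h1 := cs.length_simple_mul x r
  have h2 := cs.length_simple_mul (x * cs.simple i) r
  rw [← mul_assoc] at h2
  unfold IsRightDescent
  rcases h1 with h1 | h1
  · have := key x h (by omega)
    omega
  · have := key (cs.simple r * x) (by simpa [mul_assoc] using h) (by simp; omega)
    simp only [simple_mul_simple_cancel_left] at this
    omega

theorem isRightDescent_mul_iff_of_mem_closure {J : Set B} {v : W} {i : B}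
    (hv : v * cs.simple i * v⁻¹ ∉ Subgroup.closure (cs.simple '' J)) {h : W}
    (hh : h ∈ Subgroup.closure (cs.simple '' J)) :
    cs.IsRightDescent (h * v) i ↔ cs.IsRightDescent v i := by
  have key : ∀ r ∈ J, ∀ y ∈ Subgroup.closure (cs.simple '' J),
      (cs.IsRightDescent (y * v) i ↔ cs.IsRightDescent v i) →
      (cs.IsRightDescent (cs.simple r * y * v) i ↔ cs.IsRightDescent v i) := by
    intro r hr y hy ih
    rw [mul_assoc, isRightDescent_simple_mul_iff, ih]
    intro he
    apply hv
    have : v * cs.simple i * v⁻¹ = y⁻¹ * cs.simple r * y := by rw [← he]; group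
    rw [this]
    exact mul_mem (mul_mem (inv_mem hy) (Subgroup.subset_closure ⟨r, hr, rfl⟩)) hy
  induction hh using Subgroup.closure_induction_left with
  | one => rw [one_mul]
  | mul_left x hx y hy ih =>
    obtain ⟨r, hr, rfl⟩ := hx
    exact key r hr y hy ih
  | inv_mul_cancel x hx y hy ih =>
    obtain ⟨r, hr, rfl⟩ := hx
    rw [inv_simple]
    exact key r hr y hy ih

theorem chainLE_of_forall_length_le {J : Set B} {v : W}
    (hv : ∀ z : W, z * v⁻¹ ∈ Subgroup.closure (cs.simple '' J) → cs.length v ≤ cs.length z)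
    {h : W} (hh : h ∈ Subgroup.closure (cs.simple '' J)) : cs.ChainLE v (h * v) := by
  have key : ∀ r ∈ J, ∀ y : W, cs.ChainLE v (y * v) →
      cs.ChainLE v (cs.simple r * y * v) := by
    intro r hr y ih
    rw [mul_assoc]
    refine ih.le_simple_mul fun hd ↦ ?_
    have := hv (cs.simple r * v) (by
      rw [mul_inv_cancel_right]
      exact Subgroup.subset_closure ⟨r, hr, rfl⟩)
    exact absurd hd (by unfold IsLeftDescent; omega)
  induction hh using Subgroup.closure_induction_left with
  | one => rw [one_mul]; exact Relation.ReflTransGen.refl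
  | mul_left x hx y _ ih =>
    obtain ⟨r, hr, rfl⟩ := hx
    exact key r hr y ih
  | inv_mul_cancel x hx y _ ih =>
    obtain ⟨r, hr, rfl⟩ := hx
    rw [inv_simple]
    exact key r hr y ih

/-- If a coset of a standard parabolic subgroup contains an element below `w`, then it contains a
largest such element. -/
theorem exists_greatest_chainLE_in_coset (J : Set B) {w v : W} (hvw : cs.ChainLE v w) :
    ∃ z : W, cs.ChainLE z w ∧ z * v⁻¹ ∈ Subgroup.closure (cs.simple '' J) ∧
      ∀ x : W, cs.ChainLE x w → x * v⁻¹ ∈ Subgroup.closure (cs.simple '' J) →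
        cs.ChainLE x z := by
  induction hn : cs.length w using Nat.strong_induction_on generalizing w v with
  | _ n ih =>
  subst hn
  set H := Subgroup.closure (cs.simple '' J)
  by_cases hw1 : w = 1
  · refine ⟨w, Relation.ReflTransGen.refl, ?_, fun x hx _ ↦ hx⟩
    rcases hvw.eq_or_length_lt with rfl | h
    · simp
    · simp [hw1] at h
  obtain ⟨i, hi⟩ := cs.exists_rightDescent_of_ne_one hw1
  have hle := mul_simple_chainLE hi
  by_cases hvi : v * cs.simple i * v⁻¹ ∈ H
  · have hcoset : ∀ x : W, x * cs.simple i * v⁻¹ ∈ H ↔ x * v⁻¹ ∈ H := by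
      intro x
      rw [show x * cs.simple i * v⁻¹ = x * v⁻¹ * (v * cs.simple i * v⁻¹) by group]
      exact Subgroup.mul_mem_cancel_right _ hvi
    obtain ⟨v₀, hv₀, hv₀w⟩ : ∃ v₀ : W, v₀ * v⁻¹ ∈ H ∧ cs.ChainLE v₀ (w * cs.simple i) := by
      rcases hvw.mul_simple_le_or_le_mul_simple i with h | h
      · exact ⟨_, hvi, h⟩
      · exact ⟨v, by simp, h⟩
    have hcoset₀ : ∀ x : W, x * v₀⁻¹ ∈ H ↔ x * v⁻¹ ∈ H := by
      intro x
      rw [show x * v⁻¹ = x * v₀⁻¹ * (v₀ * v⁻¹) by group]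
      exact (Subgroup.mul_mem_cancel_right _ hv₀).symm
    obtain ⟨z', hz'w, hz', hmax⟩ := ih _ hi hv₀w rfl
    simp only [hcoset₀] at hz' hmax
    obtain ⟨z, hzw, hz, h1, h2⟩ : ∃ z : W, cs.ChainLE z w ∧ z * v⁻¹ ∈ H ∧ cs.ChainLE z' z ∧
        cs.ChainLE (z' * cs.simple i) z := by
      have hz'w' := hz'w.trans hle
      by_cases hd : cs.IsRightDescent z' i
      · exact ⟨z', hz'w', hz', Relation.ReflTransGen.refl, mul_simple_chainLE hd⟩
      · exact ⟨z' * cs.simple i, hz'w'.mul_simple_le_of_isRightDescent hi, (hcoset z').2 hz',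
          chainLE_mul_simple hd, Relation.ReflTransGen.refl⟩
    refine ⟨z, hzw, hz, fun x hxw hx ↦ ?_⟩
    rcases hxw.mul_simple_le_or_le_mul_simple i with h | h
    · have := (hmax _ h ((hcoset x).2 hx)).mul_simple_le_or_mul_simple_le i
      rw [simple_mul_simple_cancel_right] at this
      exact this.elim (·.trans h2) (·.trans h1)
    · exact (hmax _ h hx).trans h1
  · have hdesc : ∀ x : W, x * v⁻¹ ∈ H → (cs.IsRightDescent x i ↔ cs.IsRightDescent v i) := by
      intro x hx
      simpa using isRightDescent_mul_iff_of_mem_closure hvi hx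
    by_cases hd : cs.IsRightDescent v i
    · obtain ⟨z', hz'w, hz', hmax⟩ := ih _ hi (hvw.mul_simple_le_mul_simple hd) rfl
      have hz : z' * cs.simple i * v⁻¹ ∈ H := by
        simpa [mul_assoc] using hz'
      have hzd : ¬ cs.IsRightDescent z' i := by
        rw [cs.isRightDescent_iff_not_isRightDescent_mul, not_not]
        exact (hdesc _ hz).2 hd
      refine ⟨z' * cs.simple i, (hz'w.trans hle).mul_simple_le_of_isRightDescent hi, hz,
        fun x hxw hx ↦ ?_⟩
      have h := hmax _ (hxw.mul_simple_le_mul_simple ((hdesc x hx).2 hd))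
        (by simpa [mul_assoc] using hx)
      simpa using h.mul_simple_le_of_not_isRightDescent hzd
    · obtain ⟨z', hz'w, hz', hmax⟩ := ih _ hi (hvw.le_mul_simple hd) rfl
      exact ⟨z', hz'w.trans hle, hz', fun x hxw hx ↦
        hmax x (hxw.le_mul_simple (mt (hdesc x hx).1 hd)) hx⟩

end CoxeterSystem

/-- **Deodhar's lemma.**  Let `(W, S)` be a Coxeter system, `J ⊆ S`, and let `w, v ∈ W` with
`v ≤ w` in the Bruhat order and `v` of minimal length in the coset `W_J v`.  Then the set
`C(w, v) = {z ∈ W | v ≤ z ≤ w and z v⁻¹ ∈ W_J}` has a unique maximal element for the Bruhat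
order. -/
theorem deodhar {B W : Type*} [Group W] {M : CoxeterMatrix B} (cs : CoxeterSystem M W)
    (J : Set B) (w v : W)
    -- `v` is the minimal-length element of the coset `W_J v`
    (hvmin : ∀ z : W, z * v⁻¹ ∈ Subgroup.closure (cs.simple '' J) → cs.length v ≤ cs.length z)
    -- `v ≤ w` in the Bruhat order
    (hvw : cs.BruhatLE v w) :
    ∃! z : W,
      (cs.BruhatLE v z ∧ cs.BruhatLE z w ∧ z * v⁻¹ ∈ Subgroup.closure (cs.simple '' J)) ∧
      ∀ x : W, (cs.BruhatLE v x ∧ cs.BruhatLE x w ∧ x * v⁻¹ ∈ Subgroup.closure (cs.simple '' J)) →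
        cs.BruhatLE z x → x = z := by
  simp only [CoxeterSystem.bruhatLE_iff_chainLE] at hvw ⊢
  obtain ⟨z, hzw, hz, hmax⟩ := CoxeterSystem.exists_greatest_chainLE_in_coset J hvw
  have hvz : cs.ChainLE v z := by
    simpa using CoxeterSystem.chainLE_of_forall_length_le hvmin hz
  refine ⟨z, ⟨⟨hvz, hzw, hz⟩, fun x hx hzx ↦ (hmax x hx.2.1 hx.2.2).antisymm hzx⟩, ?_⟩
  rintro y ⟨⟨-, hyw, hy⟩, hymax⟩
  exact (hymax z ⟨hvz, hzw, hz⟩ (hmax y hyw hy)).symm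
end

section
/- Assume there exists an element of W^P sending −ϖ̌_i to ϖ̌_i under the dual action on V*. Then for every integer k ≥ 0, the set W^P(k) has a unique maximal element with respect to the Bruhat order; moreover, if W^P(k) ≠ W^P(k−1), this maximal element lies in W^P(k) \ W^P(k−1). -/
/-- A finite crystallographic root system `Φ` spanning a finite-dimensional real vector space
`V`, together with a fixed base of simple roots `α k`, `k : ι`.  The coroot of a root `β` is
recorded as a linear form `coroot β` on `V` (its values off `Φ` are junk). -/
structure RootSystemBase (ι V : Type) [Fintype ι] [DecidableEq ι]
    [AddCommGroup V] [Module ℝ V] [FiniteDimensional ℝ V] where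
  /-- the set of roots -/
  Φ : Set V
  finite : Φ.Finite
  spanning : Submodule.span ℝ Φ = ⊤
  /-- the simple roots -/
  α : ι → V
  /-- the coroot `β̌` of each root `β`, viewed as a linear form `⟨·, β̌⟩` on `V` -/
  coroot : V → Module.Dual ℝ V
  simple_mem : ∀ k, α k ∈ Φ
  simple_indep : LinearIndependent ℝ α
  coroot_self : ∀ β ∈ Φ, coroot β β = 2
  reflect_mem : ∀ β ∈ Φ, ∀ γ ∈ Φ, γ - coroot β γ • β ∈ Φ
  crystallographic : ∀ β ∈ Φ, ∀ γ ∈ Φ, ∃ z : ℤ, coroot β γ = (z : ℝ)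
  /-- every root is a non-negative or non-positive integral combination of the simple roots -/
  simple_base : ∀ β ∈ Φ,
    (∃ c : ι → ℕ, β = ∑ k, (c k : ℝ) • α k) ∨ (∃ c : ι → ℕ, β = -(∑ k, (c k : ℝ) • α k))

namespace RootSystemBase

variable {ι V : Type} [Fintype ι] [DecidableEq ι]
  [AddCommGroup V] [Module ℝ V] [FiniteDimensional ℝ V]
  (D : RootSystemBase ι V)

/-- the simple reflection `s k` associated with the simple root `α k` -/
noncomputable def s (k : ι) : V ≃ₗ[ℝ] V :=
  Module.reflection (D.coroot_self (D.α k) (D.simple_mem k))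

/-- the product `s k₁ * ⋯ * s kₘ` of the word `l = [k₁, …, kₘ]` in the simple reflections -/
noncomputable def wordProd (l : List ι) : V ≃ₗ[ℝ] V := (l.map D.s).prod

/-- membership in the Weyl group `W`, the group generated by the simple reflections -/
def IsWeyl (w : V ≃ₗ[ℝ] V) : Prop := ∃ l : List ι, D.wordProd l = w

/-- the length `ℓ(w)` of an element of the Weyl group -/
noncomputable def len (w : V ≃ₗ[ℝ] V) : ℕ :=
  sInf {n | ∃ l : List ι, D.wordProd l = w ∧ l.length = n}

/-- a word in the simple reflections is reduced if its length is the length of its product -/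
def IsRed (l : List ι) : Prop := D.len (D.wordProd l) = l.length

/-- the Bruhat order: `u ≤ w` iff some reduced word for `w` contains a subword which is a
reduced word for `u` -/
def BruhatLE (u w : V ≃ₗ[ℝ] V) : Prop :=
  ∃ l : List ι, D.IsRed l ∧ D.wordProd l = w ∧
    ∃ l' : List ι, l'.Sublist l ∧ D.IsRed l' ∧ D.wordProd l' = u

/-- the maximal standard parabolic subgroup `W_P` generated by the `s j` with `j ≠ i` -/
def WP (i : ι) : Subgroup (V ≃ₗ[ℝ] V) :=
  Subgroup.closure {g | ∃ k, k ≠ i ∧ g = D.s k}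

/-- the set `W^P` of minimal-length representatives of the left cosets `w W_P` -/
def WPmin (i : ι) : Set (V ≃ₗ[ℝ] V) :=
  {w | D.IsWeyl w ∧ ∀ u ∈ D.WP i, D.len w ≤ D.len (w * u)}

/-- `W^P(k)`: the set of elements of `W^P` admitting a reduced expression in which the
generator `s i` occurs at most `k` times (empty for `k < 0`) -/
def WPle (i : ι) (k : ℤ) : Set (V ≃ₗ[ℝ] V) :=
  {w | w ∈ D.WPmin i ∧ ∃ l : List ι, D.IsRed l ∧ D.wordProd l = w ∧ (l.count i : ℤ) ≤ k}

end RootSystemBase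

namespace RootSystemBase

variable {ι V : Type} [Fintype ι] [DecidableEq ι]
  [AddCommGroup V] [Module ℝ V] [FiniteDimensional ℝ V]

/-- `m` is a maximal element of `S` with respect to the Bruhat order -/
def IsBruhatMax (D : RootSystemBase ι V) (S : Set (V ≃ₗ[ℝ] V)) (m : V ≃ₗ[ℝ] V) : Prop :=
  m ∈ S ∧ ∀ x ∈ S, D.BruhatLE m x → x = m

end RootSystemBase

namespace RootSystemBase

variable {ι V : Type} [Fintype ι] [DecidableEq ι]
  [AddCommGroup V] [Module ℝ V] [FiniteDimensional ℝ V]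
  (D : RootSystemBase ι V)

/-- a vector is positive if it is a non-negative integral combination of the simple roots -/
def IsPos (v : V) : Prop := ∃ c : ι → ℕ, v = ∑ k, (c k : ℝ) • D.α k

variable {D}

lemma s_apply (k : ι) (x : V) : D.s k x = x - D.coroot (D.α k) x • D.α k :=
  Module.reflection_apply _ _

lemma s_mul_self (k : ι) : D.s k * D.s k = 1 := by
  ext x
  exact Module.involutive_reflection (D.coroot_self (D.α k) (D.simple_mem k)) x

lemma s_inv (k : ι) : (D.s k)⁻¹ = D.s k := inv_eq_of_mul_eq_one_left (s_mul_self k)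

lemma s_apply_self (k : ι) : D.s k (D.α k) = -D.α k := by
  rw [s_apply, D.coroot_self _ (D.simple_mem k), two_smul]
  abel

lemma s_mem (k : ι) {β : V} (hβ : β ∈ D.Φ) : D.s k β ∈ D.Φ := by
  rw [s_apply]
  exact D.reflect_mem _ (D.simple_mem k) _ hβ

@[simp] lemma wordProd_nil : D.wordProd [] = 1 := rfl

@[simp] lemma wordProd_cons (k : ι) (l : List ι) :
    D.wordProd (k :: l) = D.s k * D.wordProd l := by simp [wordProd]

@[simp] lemma wordProd_append (l₁ l₂ : List ι) :
    D.wordProd (l₁ ++ l₂) = D.wordProd l₁ * D.wordProd l₂ := by simp [wordProd]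

lemma isWeyl_wordProd (l : List ι) : D.IsWeyl (D.wordProd l) := ⟨l, rfl⟩

lemma isWeyl_one : D.IsWeyl 1 := ⟨[], rfl⟩

lemma isWeyl_s (k : ι) : D.IsWeyl (D.s k) := ⟨[k], by simp⟩

lemma IsWeyl.mul {u w : V ≃ₗ[ℝ] V} (hu : D.IsWeyl u) (hw : D.IsWeyl w) : D.IsWeyl (u * w) := by
  obtain ⟨l, rfl⟩ := hu
  obtain ⟨l', rfl⟩ := hw
  exact ⟨l ++ l', by simp⟩

lemma IsWeyl.inv {u : V ≃ₗ[ℝ] V} (hu : D.IsWeyl u) : D.IsWeyl u⁻¹ := by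
  obtain ⟨l, rfl⟩ := hu
  induction l with
  | nil => simpa using isWeyl_one
  | cons k l ih =>
    rw [wordProd_cons, mul_inv_rev, s_inv]
    exact ih.mul (isWeyl_s k)

lemma IsWeyl.apply_mem {w : V ≃ₗ[ℝ] V} (hw : D.IsWeyl w) {β : V} (hβ : β ∈ D.Φ) :
    w β ∈ D.Φ := by
  obtain ⟨l, rfl⟩ := hw
  induction l with
  | nil => simpa using hβ
  | cons k l ih =>
    rw [wordProd_cons]
    exact s_mem k ih

lemma finite_isWeyl : {w : V ≃ₗ[ℝ] V | D.IsWeyl w}.Finite := by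
  have : Finite D.Φ := D.finite
  refine Set.Finite.of_injOn (f := fun w (β : D.Φ) => w β)
    (t := {f : D.Φ → V | ∀ β, f β ∈ D.Φ}) (fun w hw β => hw.apply_mem β.2) ?_
    (by simpa [Set.pi] using Set.Finite.pi' (fun _ : D.Φ => D.finite))
  intro w _ w' _ h
  have : (w : V →ₗ[ℝ] V) = w' :=
    LinearMap.ext_on D.spanning fun β hβ => congrFun h ⟨β, hβ⟩
  exact LinearEquiv.toLinearMap_injective this

lemma ne_zero_of_mem {β : V} (hβ : β ∈ D.Φ) : β ≠ 0 := by
  rintro rfl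
  simpa using D.coroot_self _ hβ

lemma IsPos.or_neg {β : V} (hβ : β ∈ D.Φ) : D.IsPos β ∨ D.IsPos (-β) := by
  rcases D.simple_base β hβ with h | ⟨c, hc⟩
  · exact Or.inl h
  · exact Or.inr ⟨c, by rw [hc, neg_neg]⟩

lemma isPos_simple (k : ι) : D.IsPos (D.α k) :=
  ⟨fun j => if j = k then 1 else 0, by simp⟩

lemma IsPos.not_neg {β : V} (hβ : β ∈ D.Φ) (h : D.IsPos β) : ¬ D.IsPos (-β) := by
  rintro ⟨d, hd⟩
  obtain ⟨c, hc⟩ := h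
  have h0 : ∑ k, ((c k : ℝ) + d k) • D.α k = 0 := by
    simp only [add_smul, Finset.sum_add_distrib]
    rw [← hc, ← hd, add_neg_cancel]
  have h1 := Fintype.linearIndependent_iff.1 D.simple_indep _ h0
  apply ne_zero_of_mem hβ
  rw [hc]
  refine Finset.sum_eq_zero fun k _ => ?_
  have h2 := h1 k
  have h3 : (c k : ℝ) = 0 := by
    have := (c k).cast_nonneg (α := ℝ)
    have := (d k).cast_nonneg (α := ℝ)
    linarith
  rw [h3, zero_smul]

/-- a positive root made negative by a simple reflection is a multiple of the simple root -/
lemma IsPos.eq_smul_simple {β : V} (hβ : β ∈ D.Φ) (h : D.IsPos β) {j : ι}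
    (hj : ¬ D.IsPos (D.s j β)) : ∃ c : ℝ, β = c • D.α j := by
  obtain ⟨d, hd⟩ := (IsPos.or_neg (s_mem j hβ)).resolve_left hj
  obtain ⟨c, hc⟩ := h
  rw [s_apply] at hd
  set z := D.coroot (D.α j) β
  have h0 : ∑ k, ((c k : ℝ) + d k - if k = j then z else 0) • D.α k = 0 := by
    simp only [add_smul, sub_smul, Finset.sum_add_distrib, Finset.sum_sub_distrib]
    rw [← hc, ← hd]
    simp
  have h1 := Fintype.linearIndependent_iff.1 D.simple_indep _ h0
  refine ⟨c j, ?_⟩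
  rw [hc]
  refine Finset.sum_eq_single j (fun k _ hk => ?_) (by simp)
  have h2 := h1 k
  have h3 : (c k : ℝ) = 0 := by
    have := (c k).cast_nonneg (α := ℝ)
    have := (d k).cast_nonneg (α := ℝ)
    simp only [hk, if_false] at h2
    linarith
  rw [h3, zero_smul]

/-- the reflection in a root of the Weyl orbit of a simple root depends only on its line -/
lemma conj_s_eq {g : V ≃ₗ[ℝ] V} (hg : D.IsWeyl g) {j k : ι} {c : ℝ}
    (h : g (D.α k) = c • D.α j) : g * D.s k * g⁻¹ = D.s j := by
  have key : ∀ x, (g * D.s k * g⁻¹) x =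
      Module.preReflection (D.α j)
        (c • (D.coroot (D.α k)).comp (g⁻¹ : V ≃ₗ[ℝ] V).toLinearMap) x := by
    intro x
    have h1 : g (g⁻¹ x) = x := g.apply_symm_apply x
    simp only [LinearEquiv.mul_apply, s_apply, map_sub, map_smul, h, h1, Module.preReflection_apply,
      LinearMap.smul_apply, LinearMap.comp_apply, LinearEquiv.coe_coe, smul_smul, smul_eq_mul]
    rw [mul_comm]
  have h2 : c • (D.coroot (D.α k)).comp (g⁻¹ : V ≃ₗ[ℝ] V).toLinearMap = D.coroot (D.α j) := by
    refine Module.Dual.eq_of_preReflection_mapsTo D.finite D.spanning (x := D.α j) ?_ ?_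
      (D.coroot_self _ (D.simple_mem j)) ?_
    · rw [LinearMap.smul_apply, ← map_smul, LinearMap.comp_apply, ← h]
      have h1 : g⁻¹ (g (D.α k)) = D.α k := g.symm_apply_apply _
      rw [LinearEquiv.coe_coe, h1, D.coroot_self _ (D.simple_mem k)]
    · intro x hx
      rw [← key]
      exact ((hg.mul (isWeyl_s k)).mul hg.inv).apply_mem hx
    · intro x hx
      exact D.reflect_mem _ (D.simple_mem j) _ hx
  ext x
  rw [key, h2, s_apply, Module.preReflection_apply]

/-- the strong exchange property -/
lemma strong_exchange {g : V ≃ₗ[ℝ] V} (hg : D.IsWeyl g) {k : ι} (hpos : D.IsPos (g (D.α k)))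
    (l : List ι) (hl : ¬ D.IsPos (D.wordProd l (g (D.α k)))) :
    ∃ l' : List ι, l'.Sublist l ∧ l'.length < l.length ∧
      D.wordProd l' = D.wordProd l * (g * D.s k * g⁻¹) := by
  induction l with
  | nil => exact absurd hpos (by simpa using hl)
  | cons j l ih =>
    by_cases h : D.IsPos (D.wordProd l (g (D.α k)))
    · rw [wordProd_cons, LinearEquiv.mul_apply] at hl
      have hw := (isWeyl_wordProd l).mul hg
      obtain ⟨c, hc⟩ := h.eq_smul_simple (hw.apply_mem (D.simple_mem k)) hl
      have := conj_s_eq hw (k := k) (j := j) (c := c) hc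
      refine ⟨l, List.sublist_cons_self _ _, by simp, ?_⟩
      rw [wordProd_cons, ← this]
      have h2 := s_mul_self (D := D) k
      calc D.wordProd l = D.wordProd l * g * (D.s k * D.s k) * g⁻¹ := by rw [h2]; group
        _ = _ := by group
    · obtain ⟨l', h1, h2, h3⟩ := ih h
      exact ⟨j :: l', h1.cons_cons j, by simpa using h2, by simp [h3, mul_assoc]⟩

lemma len_wordProd_le (l : List ι) : D.len (D.wordProd l) ≤ l.length :=
  Nat.sInf_le ⟨l, rfl, rfl⟩

lemma IsWeyl.exists_isRed {w : V ≃ₗ[ℝ] V} (hw : D.IsWeyl w) :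
    ∃ l, D.IsRed l ∧ D.wordProd l = w := by
  obtain ⟨l, hl⟩ := hw
  obtain ⟨l', h1, h2⟩ := Nat.sInf_mem (s := {n | ∃ l : List ι, D.wordProd l = w ∧ l.length = n})
    ⟨l.length, l, hl, rfl⟩
  exact ⟨l', by rw [IsRed, h1, h2]; rfl, h1⟩

variable (D) in
/-- `w` is obtained from `u` by right multiplication by a reflection, increasing the length -/
def Step (u w : V ≃ₗ[ℝ] V) : Prop :=
  D.IsWeyl u ∧ ∃ g k, D.IsWeyl g ∧ D.IsPos (g (D.α k)) ∧ D.IsPos (u (g (D.α k))) ∧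
    w = u * (g * D.s k * g⁻¹)

variable (D) in
/-- the reflexive transitive closure of `Step`, i.e. the Bruhat order in terms of reflections -/
def ChainLE : (V ≃ₗ[ℝ] V) → (V ≃ₗ[ℝ] V) → Prop := Relation.ReflTransGen D.Step

variable (D) in
/-- the set of products of subwords of a word -/
def subProds (l : List ι) : Set (V ≃ₗ[ℝ] V) :=
  {u | ∃ l' : List ι, l'.Sublist l ∧ D.wordProd l' = u}

lemma step_mul_s {w : V ≃ₗ[ℝ] V} (hw : D.IsWeyl w) {k : ι} (h : D.IsPos (w (D.α k))) :
    D.Step w (w * D.s k) :=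
  ⟨hw, 1, k, isWeyl_one, isPos_simple k, h, by simp⟩

lemma step_mul_s' {w : V ≃ₗ[ℝ] V} (hw : D.IsWeyl w) {k : ι} (h : ¬ D.IsPos (w (D.α k))) :
    D.Step (w * D.s k) w := by
  have := step_mul_s (hw.mul (isWeyl_s k)) (k := k) (by
    rw [LinearEquiv.mul_apply, s_apply_self, map_neg]
    exact (IsPos.or_neg (hw.apply_mem (D.simple_mem k))).resolve_left h)
  rwa [mul_assoc, s_mul_self, mul_one] at this

lemma Step.exchange {u : V ≃ₗ[ℝ] V} {l : List ι} (h : D.Step u (D.wordProd l)) :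
    ∃ l' : List ι, l'.Sublist l ∧ l'.length < l.length ∧ D.wordProd l' = u := by
  obtain ⟨hu, g, k, hg, hpos, hupos, hw⟩ := h
  have h1 : g⁻¹ (g (D.α k)) = D.α k := g.symm_apply_apply _
  obtain ⟨l', h1, h2, h3⟩ := strong_exchange hg hpos l (by
    rw [hw]
    simp only [LinearEquiv.mul_apply, h1, s_apply_self, map_neg]
    exact hupos.not_neg ((hu.mul hg).apply_mem (D.simple_mem k)))
  refine ⟨l', h1, h2, ?_⟩
  rw [h3, hw]
  calc _ = u * g * (D.s k * D.s k) * g⁻¹ := by group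
    _ = u := by rw [s_mul_self]; group

lemma Step.isWeyl_right {u w : V ≃ₗ[ℝ] V} (h : D.Step u w) : D.IsWeyl w := by
  obtain ⟨hu, g, k, hg, -, -, rfl⟩ := h
  exact hu.mul ((hg.mul (isWeyl_s k)).mul hg.inv)

lemma Step.len_lt {u w : V ≃ₗ[ℝ] V} (h : D.Step u w) : D.len u < D.len w := by
  obtain ⟨l, hl, rfl⟩ := h.isWeyl_right.exists_isRed
  obtain ⟨l', -, h2, rfl⟩ := h.exchange
  rw [hl]
  exact (len_wordProd_le l').trans_lt h2

lemma ChainLE.mem_subProds {u w : V ≃ₗ[ℝ] V} (h : D.ChainLE u w) {l : List ι}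
    (hl : D.wordProd l = w) : u ∈ D.subProds l := by
  induction h using Relation.ReflTransGen.head_induction_on with
  | refl => exact ⟨l, List.Sublist.refl l, hl⟩
  | head h' _ ih =>
    obtain ⟨l₁, h1, rfl⟩ := ih
    obtain ⟨l₂, h2, -, h3⟩ := h'.exchange
    exact ⟨l₂, h2.trans h1, h3⟩

lemma Step.mul_s {u w : V ≃ₗ[ℝ] V} (h : D.Step u w) (k : ι) :
    D.ChainLE (u * D.s k) w ∨ D.ChainLE (u * D.s k) (w * D.s k) := by
  obtain ⟨hu, g, j, hg, hpos, hupos, rfl⟩ := h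
  by_cases hk : D.IsPos (D.s k (g (D.α j)))
  · refine Or.inr (.single ⟨hu.mul (isWeyl_s k), D.s k * g, j, (isWeyl_s k).mul hg, hk, ?_, ?_⟩)
    · rw [← LinearEquiv.mul_apply (u * D.s k), mul_assoc, ← mul_assoc (D.s k), s_mul_self, one_mul]
      exact hupos
    · rw [mul_inv_rev, s_inv]
      calc _ = u * 1 * (g * D.s j * g⁻¹) * D.s k := by group
        _ = _ := by rw [← s_mul_self (D := D) k]; group
  · obtain ⟨c, hc⟩ := hpos.eq_smul_simple (hg.apply_mem (D.simple_mem j)) hk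
    rw [conj_s_eq hg hc]
    exact Or.inl .refl

lemma ChainLE.mul_s {u w : V ≃ₗ[ℝ] V} (h : D.ChainLE u w) (k : ι) :
    D.ChainLE (u * D.s k) w ∨ D.ChainLE (u * D.s k) (w * D.s k) := by
  induction h with
  | refl => exact Or.inr .refl
  | tail _ h' ih =>
    rcases ih with ih | ih
    · exact Or.inl (ih.tail h')
    · exact (h'.mul_s k).imp ih.trans ih.trans

lemma len_mul_s_le {w : V ≃ₗ[ℝ] V} (hw : D.IsWeyl w) (k : ι) :
    D.len (w * D.s k) ≤ D.len w + 1 := by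
  obtain ⟨l, hl, rfl⟩ := hw.exists_isRed
  have := len_wordProd_le (D := D) (l ++ [k])
  rw [hl]
  simpa using this

lemma IsRed.of_append_singleton {l : List ι} {k : ι} (h : D.IsRed (l ++ [k])) : D.IsRed l := by
  have h1 := len_mul_s_le (isWeyl_wordProd (D := D) l) k
  have h2 := len_wordProd_le (D := D) l
  simp only [IsRed, wordProd_append, wordProd_cons, wordProd_nil, mul_one, List.length_append,
    List.length_cons, List.length_nil] at h ⊢
  omega

lemma IsRed.isPos {l : List ι} {k : ι} (h : D.IsRed (l ++ [k])) :
    D.IsPos (D.wordProd l (D.α k)) := by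
  by_contra hn
  have h1 := (step_mul_s' (isWeyl_wordProd l) hn).len_lt
  have h2 := len_wordProd_le (D := D) l
  simp only [IsRed, wordProd_append, wordProd_cons, wordProd_nil, mul_one, List.length_append,
    List.length_cons, List.length_nil] at h
  omega

lemma IsRed.append_singleton {l : List ι} {k : ι} (h : D.IsRed l)
    (hk : D.IsPos (D.wordProd l (D.α k))) : D.IsRed (l ++ [k]) := by
  have h1 := (step_mul_s (isWeyl_wordProd l) hk).len_lt
  have h2 := len_wordProd_le (D := D) (l ++ [k])
  simp only [IsRed, wordProd_append, wordProd_cons, wordProd_nil, mul_one, List.length_append,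
    List.length_cons, List.length_nil] at h h2 ⊢
  omega

/-- the deletion property -/
lemma exists_isRed_sublist (l : List ι) :
    ∃ l' : List ι, l'.Sublist l ∧ D.IsRed l' ∧ D.wordProd l' = D.wordProd l := by
  induction l using List.reverseRecOn with
  | nil => exact ⟨[], List.Sublist.refl _, Nat.le_zero.1 (len_wordProd_le []), rfl⟩
  | append_singleton l k ih =>
    obtain ⟨l', h1, h2, h3⟩ := ih
    by_cases hk : D.IsPos (D.wordProd l' (D.α k))
    · exact ⟨l' ++ [k], h1.append (List.Sublist.refl _), h2.append_singleton hk, by simp [h3]⟩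
    · obtain ⟨l'', h4, h5, h6⟩ := (step_mul_s' (isWeyl_wordProd l') hk).exchange
      refine ⟨l'', (h4.trans h1).trans (List.sublist_append_left _ _), ?_, by simp [h6, h3]⟩
      have h7 := len_mul_s_le (isWeyl_wordProd (D := D) l'') k
      have h8 := len_wordProd_le (D := D) l''
      rw [h6, mul_assoc, s_mul_self, mul_one, h2, ← h6] at h7
      rw [IsRed]
      omega

lemma mem_subProds_append_singleton {l : List ι} {k : ι} {u : V ≃ₗ[ℝ] V} :
    u ∈ D.subProds (l ++ [k]) ↔ u ∈ D.subProds l ∨ ∃ v ∈ D.subProds l, u = v * D.s k := by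
  constructor
  · rintro ⟨l', h, rfl⟩
    obtain ⟨l₁, l₂, rfl, h1, h2⟩ := List.sublist_append_iff.1 h
    rcases List.sublist_singleton.1 h2 with rfl | rfl
    · exact Or.inl ⟨l₁, h1, by simp⟩
    · exact Or.inr ⟨_, ⟨l₁, h1, rfl⟩, by simp⟩
  · rintro (⟨l', h, rfl⟩ | ⟨_, ⟨l', h, rfl⟩, rfl⟩)
    · exact ⟨l', h.trans (List.sublist_append_left _ _), rfl⟩
    · exact ⟨l' ++ [k], h.append (List.Sublist.refl _), by simp⟩

lemma IsRed.chainLE {l : List ι} (hl : D.IsRed l) {u : V ≃ₗ[ℝ] V} (hu : u ∈ D.subProds l) :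
    D.ChainLE u (D.wordProd l) := by
  induction l using List.reverseRecOn generalizing u with
  | nil =>
    obtain ⟨l', h, rfl⟩ := hu
    rw [List.sublist_nil.1 h]
    exact .refl
  | append_singleton l k ih =>
    have hst := step_mul_s (isWeyl_wordProd l) hl.isPos
    have ih := fun u hu => ih hl.of_append_singleton (u := u) hu
    simp only [wordProd_append, wordProd_cons, wordProd_nil, mul_one]
    rcases mem_subProds_append_singleton.1 hu with hu | ⟨v, hv, rfl⟩
    · exact (ih u hu).tail hst
    · exact ((ih v hv).mul_s k).elim (fun h => h.tail hst) id

lemma IsRed.mem_subProds_iff {l : List ι} (hl : D.IsRed l) {u : V ≃ₗ[ℝ] V} :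
    u ∈ D.subProds l ↔ D.ChainLE u (D.wordProd l) :=
  ⟨hl.chainLE, fun h => h.mem_subProds rfl⟩

lemma ChainLE.bruhatLE {u w : V ≃ₗ[ℝ] V} (hw : D.IsWeyl w) (h : D.ChainLE u w) :
    D.BruhatLE u w := by
  obtain ⟨l, hl, rfl⟩ := hw.exists_isRed
  obtain ⟨l', h1, rfl⟩ := hl.mem_subProds_iff.2 h
  obtain ⟨l'', h2, h3, h4⟩ := exists_isRed_sublist (D := D) l'
  exact ⟨l, hl, rfl, l'', h2.trans h1, h3, h4⟩

lemma BruhatLE.antisymm {u w : V ≃ₗ[ℝ] V} (h : D.BruhatLE u w) (h' : D.BruhatLE w u) :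
    u = w := by
  obtain ⟨l, hl, rfl, l', hs, hl', rfl⟩ := h
  obtain ⟨m, hm, hm1, m', hs', hm', hm2⟩ := h'
  rw [IsRed, hm1] at hm
  rw [IsRed, hm2] at hm'
  have h1 := hs'.length_le
  rw [← hm, ← hm', hl, hl'] at h1
  rw [hs.eq_of_length_le h1]

/-- the products of subwords of a word form a principal lower set -/
lemma exists_subProds_eq (l : List ι) :
    ∃ r : List ι, r.Sublist l ∧ D.IsRed r ∧ D.subProds l = D.subProds r := by
  induction l using List.reverseRecOn with
  | nil => exact ⟨[], List.Sublist.refl _, Nat.le_zero.1 (len_wordProd_le []), rfl⟩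
  | append_singleton l k ih =>
    obtain ⟨r, h1, h2, h3⟩ := ih
    by_cases hk : D.IsPos (D.wordProd r (D.α k))
    · refine ⟨r ++ [k], h1.append (List.Sublist.refl _), h2.append_singleton hk, ?_⟩
      ext u
      simp only [mem_subProds_append_singleton, h3]
    · refine ⟨r, h1.trans (List.sublist_append_left _ _), h2, ?_⟩
      have hst := step_mul_s' (isWeyl_wordProd r) hk
      ext u
      simp only [mem_subProds_append_singleton, h3, h2.mem_subProds_iff]
      refine ⟨?_, Or.inl⟩
      rintro (hu | ⟨v, hv, rfl⟩)
      · exact hu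
      · exact (hv.mul_s k).elim id fun h => h.tail hst

lemma subProds_subset_append_left (c l : List ι) : D.subProds l ⊆ D.subProds (c ++ l) := by
  rintro u ⟨l', h, rfl⟩
  exact ⟨l', h.trans (List.sublist_append_right _ _), rfl⟩

/-- a word avoiding `i` whose subword products are stable under the simple reflections of `W_P` -/
lemma exists_parabolic_word (i : ι) :
    ∃ c : List ι, i ∉ c ∧ ∀ j ≠ i, ∀ u ∈ D.subProds c, D.s j * u ∈ D.subProds c := by
  have hfin : {S | ∃ c : List ι, i ∉ c ∧ S = D.subProds c}.Finite := by
    refine (finite_isWeyl (D := D)).finite_subsets.subset ?_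
    rintro _ ⟨c, -, rfl⟩ u ⟨l', -, rfl⟩
    exact isWeyl_wordProd l'
  obtain ⟨_, ⟨c, hc, rfl⟩, hmax⟩ := hfin.exists_maximal ⟨_, [], by simp, rfl⟩
  refine ⟨c, hc, fun j hj u hu => ?_⟩
  have h1 : D.subProds (j :: c) ≤ D.subProds c :=
    hmax ⟨j :: c, by simp [hc, hj.symm], rfl⟩ (subProds_subset_append_left [j] c)
  obtain ⟨l', h, rfl⟩ := hu
  exact h1 ⟨j :: l', h.cons_cons j, by simp⟩

/-- among the elements having a word with at most `n` letters `i` there is a largest one -/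
lemma exists_universal_word (i : ι) (n : ℕ) :
    ∃ L : List ι, L.count i ≤ n ∧
      ∀ l : List ι, l.count i ≤ n → D.wordProd l ∈ D.subProds L := by
  obtain ⟨c, hc, hstab⟩ := exists_parabolic_word (D := D) i
  have hcons : ∀ R : List ι, ∀ j ≠ i, ∀ u ∈ D.subProds (c ++ R),
      D.s j * u ∈ D.subProds (c ++ R) := by
    rintro R j hj _ ⟨l', h, rfl⟩
    obtain ⟨l₁, l₂, rfl, h1, h2⟩ := List.sublist_append_iff.1 h
    obtain ⟨m, h3, h4⟩ := hstab j hj _ ⟨l₁, h1, rfl⟩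
    exact ⟨m ++ l₂, h3.append h2, by simp [h4, mul_assoc]⟩
  have hone : ∀ L : List ι, D.wordProd [] ∈ D.subProds L := fun L => ⟨[], List.nil_sublist L, rfl⟩
  induction n with
  | zero =>
    refine ⟨c, (List.count_eq_zero.2 hc).le, fun l hl => ?_⟩
    induction l with
    | nil => exact hone c
    | cons j l ih =>
      have hj : j ≠ i := by rintro rfl; simp at hl
      rw [wordProd_cons]
      exact hstab j hj _ (ih (by simpa [hj] using hl))
  | succ n ihn =>
    obtain ⟨L, hL, hLu⟩ := ihn
    refine ⟨c ++ i :: L, ?_, fun l hl => ?_⟩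
    · simpa [List.count_eq_zero.2 hc] using hL
    induction l with
    | nil => exact hone _
    | cons j l ih =>
      by_cases hj : j = i
      · subst hj
        obtain ⟨l', h1, h2⟩ := hLu l (by simpa using hl)
        exact subProds_subset_append_left _ _ ⟨j :: l', h1.cons_cons j, by simp [h2]⟩
      · rw [wordProd_cons]
        exact hcons _ j hj _ (ih (by simpa [hj] using hl))

lemma exists_word_of_mem_WP {i : ι} {p : V ≃ₗ[ℝ] V} (hp : p ∈ D.WP i) :
    ∃ l : List ι, i ∉ l ∧ D.wordProd l = p := by
  induction hp using Subgroup.closure_induction'' with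
  | mem x hx =>
    obtain ⟨k, hk, rfl⟩ := hx
    exact ⟨[k], by simpa using hk.symm, by simp⟩
  | inv_mem x hx =>
    obtain ⟨k, hk, rfl⟩ := hx
    exact ⟨[k], by simpa using hk.symm, by simp [s_inv]⟩
  | one => exact ⟨[], by simp, rfl⟩
  | mul x y _ _ hx hy =>
    obtain ⟨l, hl, rfl⟩ := hx
    obtain ⟨l', hl', rfl⟩ := hy
    exact ⟨l ++ l', by simp [hl, hl'], by simp⟩

lemma s_mem_WP {i j : ι} (hj : j ≠ i) : D.s j ∈ D.WP i := Subgroup.subset_closure ⟨j, hj, rfl⟩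

/-- every coset of `W_P` contains an element of `W^P` -/
lemma exists_mul_mem_WPmin (i : ι) {w : V ≃ₗ[ℝ] V} (hw : D.IsWeyl w) :
    ∃ p ∈ D.WP i, w * p ∈ D.WPmin i := by
  obtain ⟨p, hp, hmin⟩ := exists_minimalFor_of_wellFoundedLT (· ∈ D.WP i)
    (fun p => D.len (w * p)) ⟨1, one_mem _⟩
  obtain ⟨l, -, rfl⟩ := exists_word_of_mem_WP hp
  refine ⟨_, hp, hw.mul (isWeyl_wordProd l), fun u hu => ?_⟩
  rw [mul_assoc]
  rcases le_total (D.len (w * D.wordProd l)) (D.len (w * (D.wordProd l * u))) with h | h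
  · exact h
  · exact hmin (mul_mem hp hu) h

lemma ChainLE.of_mul_s {i j : ι} (hj : j ≠ i) {w v : V ≃ₗ[ℝ] V} (hw : w ∈ D.WPmin i)
    (hv : D.IsWeyl v) (h : D.ChainLE w (v * D.s j)) : D.ChainLE w v := by
  by_cases hpos : D.IsPos (v (D.α j))
  · obtain ⟨l, hl, rfl⟩ := hv.exists_isRed
    have h1 := h.mem_subProds (l := l ++ [j]) (by simp)
    rcases mem_subProds_append_singleton.1 h1 with h2 | ⟨v, h2, rfl⟩
    · exact hl.chainLE h2
    · have hvW : D.IsWeyl v := by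
        obtain ⟨l', -, rfl⟩ := h2
        exact isWeyl_wordProd l'
      refine Relation.ReflTransGen.head (step_mul_s' hvW fun h3 => ?_) (hl.chainLE h2)
      have h4 := (step_mul_s hvW h3).len_lt
      have h5 := hw.2 _ (s_mem_WP hj)
      rw [mul_assoc, s_mul_self, mul_one] at h5
      omega
  · exact h.tail (step_mul_s' hv hpos)

lemma ChainLE.of_mul_mem_WP {i : ι} {w v p : V ≃ₗ[ℝ] V} (hw : w ∈ D.WPmin i)
    (hv : D.IsWeyl v) (hp : p ∈ D.WP i) (h : D.ChainLE w (v * p)) : D.ChainLE w v := by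
  obtain ⟨l, hl, rfl⟩ := exists_word_of_mem_WP hp
  clear hp
  induction l using List.reverseRecOn with
  | nil => simpa using h
  | append_singleton l j ih =>
    simp only [List.mem_append, List.mem_singleton, not_or] at hl
    refine ih hl.1 (ChainLE.of_mul_s (Ne.symm hl.2) hw (hv.mul (isWeyl_wordProd l)) ?_)
    simpa [mul_assoc] using h

lemma mem_WPle_of_word {i : ι} {k : ℤ} {l : List ι} (h : D.wordProd l ∈ D.WPmin i)
    (hl : (l.count i : ℤ) ≤ k) : D.wordProd l ∈ D.WPle i k := by
  obtain ⟨l', h1, h2, h3⟩ := exists_isRed_sublist (D := D) l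
  refine ⟨h, l', h2, h3, le_trans ?_ hl⟩
  exact_mod_cast h1.count_le i

/-- `W^P(n)` has a largest element -/
lemma exists_greatest_WPle (i : ι) (n : ℕ) :
    ∃ m ∈ D.WPle i n, ∀ w ∈ D.WPle i n, D.ChainLE w m := by
  obtain ⟨L, hL, hLu⟩ := exists_universal_word (D := D) i n
  obtain ⟨r, hrL, hr, hLr⟩ := exists_subProds_eq (D := D) L
  obtain ⟨p, hp, hmin⟩ := exists_mul_mem_WPmin i (isWeyl_wordProd (D := D) r)
  refine ⟨D.wordProd r * p, ?_, fun w hw => ?_⟩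
  · obtain ⟨l, hl, rfl⟩ := exists_word_of_mem_WP hp
    rw [← wordProd_append] at hmin ⊢
    refine mem_WPle_of_word hmin ?_
    have := hrL.count_le i
    rw [List.count_append, List.count_eq_zero.2 hl]
    omega
  · obtain ⟨hw, l, -, rfl, hl⟩ := hw
    refine ChainLE.of_mul_mem_WP hw hmin.1 (inv_mem hp) ?_
    rw [mul_inv_cancel_right]
    refine hr.chainLE ?_
    rw [← hLr]
    exact hLu l (by exact_mod_cast hl)

end RootSystemBase

open RootSystemBase in
/-- Assume some element of `W^P` sends `−ϖ̌_i` to `ϖ̌_i` under the dual action on `V*`.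
Then for every integer `k ≥ 0` the set `W^P(k)` has a unique maximal element for the Bruhat
order, and if `W^P(k) ≠ W^P(k−1)` this maximal element lies in `W^P(k) \ W^P(k−1)`. -/
theorem statement4 {ι V : Type} [Fintype ι] [DecidableEq ι]
    [AddCommGroup V] [Module ℝ V] [FiniteDimensional ℝ V]
    (D : RootSystemBase ι V) (i : ι)
    -- the fundamental coweight `ϖ̌_i`, characterized by `⟨α_k, ϖ̌_i⟩ = δ_{ik}`
    (ϖc : Module.Dual ℝ V) (hϖc : ∀ k, ϖc (D.α k) = if k = i then 1 else 0)
    -- some element of `W^P` sends `−ϖ̌_i` to `ϖ̌_i` under the dual action `(w·f)(x) = f(w⁻¹x)`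
    (hhat : ∃ what ∈ D.WPmin i, ∀ x : V, -(ϖc (what.symm x)) = ϖc x) :
    ∀ k : ℤ, 0 ≤ k →
      (∃! m, D.IsBruhatMax (D.WPle i k) m) ∧
      (D.WPle i k ≠ D.WPle i (k - 1) →
        ∀ m, D.IsBruhatMax (D.WPle i k) m → m ∈ D.WPle i k \ D.WPle i (k - 1)) := by
  intro k hk
  lift k to ℕ using hk
  obtain ⟨m, hm, hgreat⟩ := exists_greatest_WPle (D := D) i k
  have hle : ∀ w ∈ D.WPle i k, D.BruhatLE w m := fun w hw => (hgreat w hw).bruhatLE hm.1.1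
  have hmax : D.IsBruhatMax (D.WPle i k) m := ⟨hm, fun x hx h => (hle x hx).antisymm h⟩
  have huniq : ∀ m', D.IsBruhatMax (D.WPle i k) m' → m' = m :=
    fun m' h => (h.2 m hm (hle m' h.1)).symm
  refine ⟨⟨m, hmax, huniq⟩, fun hne m' hm' => ?_⟩
  rw [huniq m' hm']
  refine ⟨hm, fun hmem => hne (Set.Subset.antisymm (fun w hw => ?_) ?_)⟩
  · obtain ⟨-, l, -, hl, hcount⟩ := hmem
    obtain ⟨l', hsub, rfl⟩ := (hgreat w hw).mem_subProds hl
    refine mem_WPle_of_word hw.1 (le_trans ?_ hcount)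
    exact_mod_cast hsub.count_le i
  · rintro w ⟨hw, l, hl, hlw, hcount⟩
    exact ⟨hw, l, hl, hlw, hcount.trans (by omega)⟩
end
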